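/- Suppose that: (a) for every d₀ ∈ [0, D] the map t ↦ δmax(d₀, t) is non-increasing; (b) δ(y₀, t + Δt) < δ(y₀, t) for all t ≥ 0 and all y₀ ∈ 𝓛 with y₀ ≠ y_g; (c) δmax(0, t) = 0 for all t ≥ 0; and (d) the map d₀ ↦ δmax(d₀, 0) is surjective from [0, D] onto [0, M], where M = sup_{(y₀,t)} δ(y₀, t). Then for every d₀ ∈ [0, D], δmax(d₀, t) → 0 as t → ∞, and consequently β(d₀, t) → 0 as t → ∞. -/

import Mathlib

open Metric Set Filter Topology

noncomputable def deltaFn {m : ℕ} (yg : EuclideanSpace ℝ (Fin m))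
    (Φ : ℝ → EuclideanSpace ℝ (Fin m) → EuclideanSpace ℝ (Fin m))
    (y₀ : EuclideanSpace ℝ (Fin m)) (t : ℝ) : ℝ :=
  ‖yg - Φ t y₀‖

noncomputable def deltaMaxW {m : ℕ} (yg : EuclideanSpace ℝ (Fin m))
    (Φ : ℝ → EuclideanSpace ℝ (Fin m) → EuclideanSpace ℝ (Fin m))
    (Δt : ℝ) (y₀ : EuclideanSpace ℝ (Fin m)) (t : ℝ) : ℝ :=
  sSup ((fun s => deltaFn yg Φ y₀ s) '' Set.Icc t (t + Δt))

noncomputable def deltaMax {m : ℕ} (yg : EuclideanSpace ℝ (Fin m))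
    (Φ : ℝ → EuclideanSpace ℝ (Fin m) → EuclideanSpace ℝ (Fin m))
    (Δt : ℝ) (d₀ t : ℝ) : ℝ :=
  sSup ((fun y₀ => deltaMaxW yg Φ Δt y₀ t) '' Metric.sphere yg d₀)

noncomputable def betaFn {m : ℕ} (yg : EuclideanSpace ℝ (Fin m))
    (Φ : ℝ → EuclideanSpace ℝ (Fin m) → EuclideanSpace ℝ (Fin m))
    (Δt α : ℝ) (d₀ t : ℝ) : ℝ :=
  Real.exp (α * t) * (deltaMax yg Φ Δt d₀ 0 + d₀)
    - α * ∫ s in (0:ℝ)..t, Real.exp (α * (t - s)) * deltaMax yg Φ Δt d₀ s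

/-- A Lyapunov function that strictly decreases along a continuous self-map of a compact set, away
from its zeros, tends to zero along the iterates, uniformly on the set. -/
theorem IsCompact.exists_forall_iterate_lt {X : Type*} [TopologicalSpace X] {K : Set X}
    (hK : IsCompact K) {P : X → X} {V : X → ℝ} (hPK : MapsTo P K K) (hP : ContinuousOn P K)
    (hV : ContinuousOn V K) (hle : ∀ x ∈ K, V (P x) ≤ V x)
    (hlt : ∀ x ∈ K, 0 < V x → V (P x) < V x) {ε : ℝ} (hε : 0 < ε) :
    ∃ N : ℕ, ∀ n ≥ N, ∀ x ∈ K, V (P^[n] x) < ε := by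
  obtain ⟨B, hB⟩ := hK.bddAbove_image hV
  obtain ⟨c, hc, hdec⟩ : ∃ c > 0, ∀ x ∈ K, ε ≤ V x → V (P x) ≤ V x - c := by
    have hW : ContinuousOn (fun x => V x - V (P x)) K := hV.sub (hV.comp hP hPK)
    rcases (K ∩ {x | ε ≤ V x}).eq_empty_or_nonempty with h | h
    · exact ⟨1, one_pos, fun x hx hxε => (eq_empty_iff_forall_notMem.1 h x ⟨hx, hxε⟩).elim⟩
    · have hS : IsCompact (K ∩ {x | ε ≤ V x}) := by
        obtain ⟨u, hu, hKu⟩ := continuousOn_iff_isClosed.1 hV (Ici ε) isClosed_Ici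
        have : K ∩ {x | ε ≤ V x} = K ∩ u := by
          rw [inter_comm K u, ← hKu, inter_comm]
          rfl
        exact this ▸ hK.inter_right hu
      obtain ⟨z, hz, hmin⟩ := hS.exists_isMinOn h (hW.mono inter_subset_left)
      refine ⟨V z - V (P z), sub_pos.2 (hlt z hz.1 (hε.trans_le hz.2)), fun x hx hxε => ?_⟩
      have : V z - V (P z) ≤ V x - V (P x) := hmin ⟨hx, hxε⟩
      linarith
  have key : ∀ (n : ℕ), ∀ x ∈ K, V (P^[n] x) < ε ∨ V (P^[n] x) ≤ V x - n * c := by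
    intro n x hx
    induction n with
    | zero => simp
    | succ n ih =>
      have hn := hPK.iterate n hx
      rw [Function.iterate_succ_apply']
      rcases lt_or_ge (V (P^[n] x)) ε with h | h
      · exact .inl ((hle _ hn).trans_lt h)
      · have h1 := hdec _ hn h
        have h2 := ih.resolve_left h.not_gt
        right
        push_cast
        linarith
  obtain ⟨N, hN⟩ := exists_nat_gt ((B - ε) / c)
  refine ⟨N, fun n hn x hx => (key n x hx).elim id fun h => ?_⟩
  have h1 : V x ≤ B := hB (mem_image_of_mem V hx)
  have h2 : (B - ε) / c < n := hN.trans_le (by exact_mod_cast hn)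
  rw [div_lt_iff₀ hc] at h2
  linarith

/-- Solutions of `y' = f y` that stay in a set on which `f` is `K`-Lipschitz separate at most
exponentially. -/
theorem LipschitzOnWith.dist_flow_le {E : Type*} [NormedAddCommGroup E] [NormedSpace ℝ E]
    {f : E → E} {S : Set E} {K : NNReal} (hf : LipschitzOnWith K f S) {Φ : ℝ → E → E}
    (hΦ0 : ∀ x ∈ S, Φ 0 x = x) (hΦS : ∀ t : ℝ, 0 ≤ t → ∀ x ∈ S, Φ t x ∈ S)
    (hΦ : ∀ t : ℝ, 0 ≤ t → ∀ x ∈ S, HasDerivAt (fun τ => Φ τ x) (f (Φ t x)) t)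
    {x y : E} (hx : x ∈ S) (hy : y ∈ S) {t : ℝ} (ht : 0 ≤ t) :
    dist (Φ t x) (Φ t y) ≤ dist x y * Real.exp (K * t) := by
  have hcont : ∀ z ∈ S, ContinuousOn (fun τ => Φ τ z) (Icc 0 t) := fun z hz τ hτ =>
    (hΦ τ hτ.1 z hz).continuousAt.continuousWithinAt
  have := dist_le_of_trajectories_ODE_of_mem (v := fun _ => f) (s := fun _ => S) (K := K)
    (a := 0) (b := t) (f := fun τ => Φ τ x) (g := fun τ => Φ τ y) (δ := dist x y)
    (fun _ _ => hf) (hcont x hx)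
    (fun τ hτ => (hΦ τ hτ.1 x hx).hasDerivWithinAt) (fun τ hτ => hΦS τ hτ.1 x hx) (hcont y hy)
    (fun τ hτ => (hΦ τ hτ.1 y hy).hasDerivWithinAt) (fun τ hτ => hΦS τ hτ.1 y hy)
    (by simp [hΦ0 x hx, hΦ0 y hy]) t (right_mem_Icc.2 ht)
  simpa using this

/-- Convolving a monotonically vanishing function with a decaying exponential gives a vanishing
function. -/
theorem AntitoneOn.tendsto_integral_exp_mul {g : ℝ → ℝ} (hg : AntitoneOn g (Ici 0))
    (hg0 : ∀ t, 0 ≤ t → 0 ≤ g t) (hlim : Tendsto g atTop (𝓝 0)) {α : ℝ} (hα : α < 0) :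
    Tendsto (fun t => ∫ s in (0 : ℝ)..t, Real.exp (α * (t - s)) * g s) atTop (𝓝 0) := by
  have hmeas : Measurable fun s => g (max s 0) :=
    Antitone.measurable fun a b hab =>
      hg (le_max_right a 0) (le_max_right b 0) (max_le_max_right 0 hab)
  have hexp : MeasureTheory.IntegrableOn (fun s => Real.exp (α * s)) (Ioi 0) := by
    simpa using exp_neg_integrableOn_Ioi 0 (neg_pos.2 hα)
  have hbound : ∀ t s : ℝ, ‖Real.exp (α * s) * g (max (t - s) 0)‖ ≤ Real.exp (α * s) * g 0 := by
    intro t s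
    have hm : (0 : ℝ) ≤ max (t - s) 0 := le_max_right _ _
    rw [Real.norm_of_nonneg (mul_nonneg (Real.exp_pos _).le (hg0 _ hm))]
    exact mul_le_mul_of_nonneg_left (hg self_mem_Ici hm hm) (Real.exp_pos _).le
  have hmeas' : ∀ t : ℝ, Measurable fun s => Real.exp (α * s) * g (max (t - s) 0) := fun t =>
    (by fun_prop : Measurable fun s : ℝ => Real.exp (α * s)).mul
      (hmeas.comp (measurable_const.sub measurable_id))
  have hbig : Tendsto (fun t => ∫ s in Ioi (0 : ℝ), Real.exp (α * s) * g (max (t - s) 0))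
      atTop (𝓝 0) := by
    have h := MeasureTheory.tendsto_integral_filter_of_dominated_convergence
      (μ := MeasureTheory.volume.restrict (Ioi (0 : ℝ))) (l := atTop)
      (F := fun t s : ℝ => Real.exp (α * s) * g (max (t - s) 0)) (f := fun _ => 0)
      (fun s => Real.exp (α * s) * g 0)
      (.of_forall fun t => (hmeas' t).aestronglyMeasurable)
      (.of_forall fun t => .of_forall (hbound t)) (hexp.mul_const (g 0)) (.of_forall fun s => by
        have h1 : Tendsto (fun t : ℝ => max (t - s) 0) atTop atTop :=
          tendsto_atTop_mono (fun t => le_max_left _ _)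
            (tendsto_atTop_add_const_right _ (-s) tendsto_id)
        simpa using (hlim.comp h1).const_mul (Real.exp (α * s)))
    simpa using h
  refine tendsto_of_tendsto_of_tendsto_of_le_of_le' tendsto_const_nhds hbig ?_ ?_
  · filter_upwards [eventually_ge_atTop 0] with t ht
    exact intervalIntegral.integral_nonneg ht fun s hs =>
      mul_nonneg (Real.exp_pos _).le (hg0 s hs.1)
  · filter_upwards [eventually_ge_atTop 0] with t ht
    have hsub : ∫ s in (0 : ℝ)..t, Real.exp (α * (t - s)) * g s =
        ∫ s in (0 : ℝ)..t, Real.exp (α * s) * g (t - s) := by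
      simpa using
        intervalIntegral.integral_comp_sub_left (a := 0) (b := t)
          (fun s => Real.exp (α * (t - s)) * g s) t |>.symm
    have hmax : ∫ s in (0 : ℝ)..t, Real.exp (α * s) * g (t - s) =
        ∫ s in (0 : ℝ)..t, Real.exp (α * s) * g (max (t - s) 0) := by
      refine intervalIntegral.integral_congr fun s hs => ?_
      rw [uIcc_of_le ht] at hs
      simp only [max_eq_left (sub_nonneg.2 hs.2)]
    rw [hsub, hmax, intervalIntegral.integral_of_le ht]
    refine MeasureTheory.setIntegral_mono_set ?_ ?_ (.of_forall Ioc_subset_Ioi_self)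
    · exact (hexp.mul_const (g 0)).mono' (hmeas' t).aestronglyMeasurable (.of_forall (hbound t))
    · exact .of_forall fun s => mul_nonneg (Real.exp_pos _).le (hg0 _ (le_max_right _ _))

theorem deltaMax_nonneg {m : ℕ} (yg : EuclideanSpace ℝ (Fin m))
    (Φ : ℝ → EuclideanSpace ℝ (Fin m) → EuclideanSpace ℝ (Fin m)) (Δt d₀ t : ℝ) :
    0 ≤ deltaMax yg Φ Δt d₀ t := by
  refine Real.sSup_nonneg ?_
  rintro _ ⟨y, -, rfl⟩
  refine Real.sSup_nonneg ?_
  rintro _ ⟨s, -, rfl⟩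
  exact norm_nonneg _

theorem deltaMax_le {m : ℕ} {yg : EuclideanSpace ℝ (Fin m)}
    {Φ : ℝ → EuclideanSpace ℝ (Fin m) → EuclideanSpace ℝ (Fin m)} {Δt d₀ t η : ℝ} (hη : 0 ≤ η)
    (h : ∀ y ∈ sphere yg d₀, ∀ s ≥ t, deltaFn yg Φ y s ≤ η) :
    deltaMax yg Φ Δt d₀ t ≤ η := by
  refine Real.sSup_le ?_ hη
  rintro _ ⟨y, hy, rfl⟩
  refine Real.sSup_le ?_ hη
  rintro _ ⟨s, hs, rfl⟩
  exact h y hy s hs.1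

theorem stmt_14
    (m : ℕ) (hm : 1 ≤ m)
    (yg : EuclideanSpace ℝ (Fin m)) (D : ℝ) (hD : 0 < D)
    (f : EuclideanSpace ℝ (Fin m) → EuclideanSpace ℝ (Fin m))
    (hf : ContDiff ℝ 1 f)
    (Φ : ℝ → EuclideanSpace ℝ (Fin m) → EuclideanSpace ℝ (Fin m))
    (hΦ0 : ∀ y₀ ∈ Metric.closedBall yg D, Φ 0 y₀ = y₀)
    (hΦinv : ∀ t : ℝ, 0 ≤ t → ∀ y₀ ∈ Metric.closedBall yg D,
      Φ t y₀ ∈ Metric.closedBall yg D)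
    (hΦderiv : ∀ t : ℝ, 0 ≤ t → ∀ y₀ ∈ Metric.closedBall yg D,
      HasDerivAt (fun τ => Φ τ y₀) (f (Φ t y₀)) t)
    (hΦflow : ∀ s : ℝ, 0 ≤ s → ∀ t : ℝ, 0 ≤ t → ∀ y₀ ∈ Metric.closedBall yg D,
      Φ (s + t) y₀ = Φ t (Φ s y₀))
    (Δt : ℝ) (hΔt : 0 < Δt) (α : ℝ) (hα : α < 0)
    (ha : ∀ d₀ ∈ Set.Icc (0:ℝ) D,
      AntitoneOn (fun t => deltaMax yg Φ Δt d₀ t) (Set.Ici 0))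
    (hb : ∀ t : ℝ, 0 ≤ t → ∀ y₀ ∈ Metric.closedBall yg D, y₀ ≠ yg →
      deltaFn yg Φ y₀ (t + Δt) < deltaFn yg Φ y₀ t)
    (hc : ∀ t : ℝ, 0 ≤ t → deltaMax yg Φ Δt 0 t = 0)
    (hd : ∀ a ∈ Set.Icc (0:ℝ)
        (sSup (Set.image2 (fun y₀ t => deltaFn yg Φ y₀ t)
          (Metric.closedBall yg D) (Set.Ici 0))),
      ∃ d₀ ∈ Set.Icc (0:ℝ) D, deltaMax yg Φ Δt d₀ 0 = a) :
    ∀ d₀ ∈ Set.Icc (0:ℝ) D,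
      Filter.Tendsto (fun t => deltaMax yg Φ Δt d₀ t) Filter.atTop (𝓝 0) ∧
      Filter.Tendsto (fun t => betaFn yg Φ Δt α d₀ t) Filter.atTop (𝓝 0) := by
  have hyg : yg ∈ closedBall yg D := mem_closedBall_self hD.le
  have hδ : ∀ t y, deltaFn yg Φ y t = dist (Φ t y) yg := fun t y => by
    rw [deltaFn, dist_comm, dist_eq_norm]
  have hfix : ∀ t : ℝ, 0 ≤ t → Φ t yg = yg := by
    intro t ht
    have h0 : deltaMaxW yg Φ Δt yg t = 0 := by
      simpa [deltaMax, sphere_zero] using hc t ht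
    have hle : deltaFn yg Φ yg t ≤ deltaMaxW yg Φ Δt yg t := by
      refine le_csSup ⟨D, ?_⟩ ⟨t, ⟨le_rfl, by linarith⟩, rfl⟩
      rintro _ ⟨s, hs, rfl⟩
      simpa only [hδ] using mem_closedBall.1 (hΦinv s (ht.trans hs.1) yg hyg)
    rw [h0, hδ] at hle
    exact dist_le_zero.1 hle
  obtain ⟨K, hK⟩ := (hf.locallyLipschitz.locallyLipschitzOn
    (s := closedBall yg D)).exists_lipschitzOnWith_of_compact (isCompact_closedBall yg D)
  have hgron : ∀ t : ℝ, 0 ≤ t → ∀ x ∈ closedBall yg D, ∀ y ∈ closedBall yg D,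
      dist (Φ t x) (Φ t y) ≤ dist x y * Real.exp (K * t) := fun t ht x hx y hy =>
    hK.dist_flow_le hΦ0 hΦinv hΦderiv hx hy ht
  have hcont : ContinuousOn (Φ Δt) (closedBall yg D) := by
    refine (LipschitzOnWith.of_dist_le_mul (K := (Real.exp (K * Δt)).toNNReal)
      fun x hx y hy => ?_).continuousOn
    rw [Real.coe_toNNReal _ (Real.exp_pos _).le, mul_comm]
    exact hgron Δt hΔt.le x hx y hy
  have hlt : ∀ y ∈ closedBall yg D, y ≠ yg → dist (Φ Δt y) yg < dist y yg := by
    intro y hy hne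
    simpa [hδ, hΦ0 y hy] using hb 0 le_rfl y hy hne
  have hle : ∀ y ∈ closedBall yg D, dist (Φ Δt y) yg ≤ dist y yg := by
    intro y hy
    rcases eq_or_ne y yg with rfl | hne
    · rw [hfix Δt hΔt.le]
    · exact (hlt y hy hne).le
  have hiter : ∀ (n : ℕ), ∀ y ∈ closedBall yg D, (Φ Δt)^[n] y = Φ (n * Δt) y := by
    intro n y hy
    induction n with
    | zero => simp [hΦ0 y hy]
    | succ n ih =>
      rw [Function.iterate_succ_apply', ih, ← hΦflow _ (by positivity) _ hΔt.le y hy]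
      push_cast
      ring_nf
  have hunif : ∀ η > 0, ∃ T : ℝ, ∀ y ∈ closedBall yg D, ∀ s ≥ T, deltaFn yg Φ y s ≤ η := by
    intro η hη
    have hE := Real.exp_pos (K * Δt)
    obtain ⟨N, hN⟩ := (isCompact_closedBall yg D).exists_forall_iterate_lt
      (V := fun y => dist y yg) (fun y hy => hΦinv Δt hΔt.le y hy) hcont
      (by fun_prop) hle (fun y hy h => hlt y hy (dist_pos.1 h)) (div_pos hη hE)
    refine ⟨N * Δt, fun y hy s hs => ?_⟩
    have hs0 : 0 ≤ s := le_trans (by positivity) hs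
    set n := ⌊s / Δt⌋₊
    have hn1 : n * Δt ≤ s := (le_div_iff₀ hΔt).1 (Nat.floor_le (by positivity))
    have hn2 : s < (n + 1) * Δt := (div_lt_iff₀ hΔt).1 (Nat.lt_floor_add_one _)
    have hNn : N ≤ n := Nat.le_floor ((le_div_iff₀ hΔt).2 hs)
    have hr : 0 ≤ s - n * Δt := sub_nonneg.2 hn1
    have hn0 : 0 ≤ n * Δt := by positivity
    have h1 := hN n hNn y hy
    simp only [hiter n y hy] at h1
    have h2 := hgron _ hr _ (hΦinv _ hn0 y hy) yg hyg
    rw [hfix _ hr, ← hΦflow _ hn0 _ hr y hy, add_sub_cancel] at h2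
    rw [hδ]
    calc dist (Φ s y) yg ≤ dist (Φ (n * Δt) y) yg * Real.exp (K * (s - n * Δt)) := h2
      _ ≤ η / Real.exp (K * Δt) * Real.exp (K * Δt) := by
        gcongr
        linarith
      _ = η := div_mul_cancel₀ _ hE.ne'
  intro d₀ hd₀
  have hlim : Tendsto (fun t => deltaMax yg Φ Δt d₀ t) atTop (𝓝 0) := by
    refine Metric.tendsto_atTop.2 fun ε hε => ?_
    obtain ⟨T, hT⟩ := hunif (ε / 2) (half_pos hε)
    refine ⟨T, fun t ht => ?_⟩
    rw [Real.dist_0_eq_abs, abs_of_nonneg (deltaMax_nonneg ..)]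
    refine (deltaMax_le (half_pos hε).le fun y hy s hs => ?_).trans_lt (half_lt_self hε)
    exact hT y (closedBall_subset_closedBall hd₀.2 (sphere_subset_closedBall hy)) s (ht.trans hs)
  refine ⟨hlim, ?_⟩
  have hexp : Tendsto (fun t => Real.exp (α * t)) atTop (𝓝 0) :=
    Real.tendsto_exp_atBot.comp (tendsto_id.const_mul_atTop_of_neg hα)
  have hint := (ha d₀ hd₀).tendsto_integral_exp_mul (fun t _ => deltaMax_nonneg ..) hlim hα
  simpa [betaFn] using
    (hexp.mul_const (deltaMax yg Φ Δt d₀ 0 + d₀)).sub (hint.const_mul α)
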